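/- arXiv:gr-qc/9801023 — 2 statements merged into one kernel-verified Lean document; each statement's English description precedes it below -/
import Mathlib

section
/- For a perfect fluid satisfying the conservation equations and the Yang compatibility condition ∇_{[a}T_{b]c} = 0, transvection with u gives (μ+p)(3u_{[b} u̇_{c]} − ∇_{[c}u_{b]}) = 0, and a further transvection with u^b yields (μ+p) u̇_a = 0; hence if μ+p ≠ 0 the fluid flow lines are geodesic. -/
/-- For a perfect fluid (`T_{ab} = (μ+p)u_au_b + p g_{ab}`, `u_au^a = −1`) with constant
trace, satisfying the conservation equations and the Yang compatibility condition
`∇_{[a}T_{b]c} = 0`, transvection with `u` gives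
`(μ+p)(3u_{[b}u̇_{c]} − ∇_{[c}u_{b]}) = 0`, a further transvection with `u^b` gives
`(μ+p)u̇_a = 0`; hence if `μ+p ≠ 0` the flow lines are geodesic (`u̇ = 0`).
Pointwise formulation with `Du a b = ∇_a u_b`, `Dμ`, `Dp` the gradients of `μ`, `p`,
`uup` the raised velocity, `udot` the acceleration, `θ` the expansion, and `DT` the
covariant derivative of `T` (Leibniz expansion). -/
theorem yang_perfect_fluid_geodesic_flow
    (g ginv : Fin 4 → Fin 4 → ℝ)
    (hginv : ∀ a b, (∑ e, ginv a e * g e b) = if a = b then (1:ℝ) else 0)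
    (μ p : ℝ) (u Dμ Dp : Fin 4 → ℝ)
    (Du : Fin 4 → Fin 4 → ℝ)
    (hunit : (∑ a, ∑ b, ginv a b * u a * u b) = -1)
    (uup : Fin 4 → ℝ) (huup : ∀ a, uup a = ∑ b, ginv a b * u b)
    (udot : Fin 4 → ℝ) (hudot : ∀ a, udot a = ∑ b, uup b * Du b a)
    (θ : ℝ) (hθ : θ = ∑ a, ∑ b, ginv a b * Du a b)
    (μdot : ℝ) (hμdot : μdot = ∑ a, uup a * Dμ a)
    (pdot : ℝ) (hpdot : pdot = ∑ a, uup a * Dp a)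
    (htraceconst : ∀ a, -Dμ a + 3 * Dp a = 0)
    (hcons1 : μdot + θ * (μ + p) = 0)
    (hcons2 : ∀ a, Dp a + pdot * u a + (μ + p) * udot a = 0)
    (DT : Fin 4 → Fin 4 → Fin 4 → ℝ)
    (hDT : ∀ a b c, DT a b c = (Dμ a + Dp a) * u b * u c
        + (μ + p) * (Du a b * u c + u b * Du a c) + Dp a * g b c)
    (hYang : ∀ a b c, DT a b c = DT b a c) :
    (∀ b c, (μ + p) * ((3/2) * (u b * udot c - u c * udot b)
        - (1/2) * (Du c b - Du b c)) = 0) ∧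
    (∀ a, (μ + p) * udot a = 0) ∧
    (μ + p ≠ 0 → ∀ a, udot a = 0) := by
  have hgginv (a b : Fin 4) : ∑ e, g a e * ginv e b = if a = b then (1 : ℝ) else 0 := by
    have h : Matrix.of ginv * Matrix.of g = 1 := by
      ext a b
      simpa [Matrix.mul_apply, Matrix.one_apply] using hginv a b
    have h' := Matrix.ext_iff.mpr (mul_eq_one_comm.mp h) a b
    simpa [Matrix.mul_apply, Matrix.one_apply] using h'
  have huu : ∑ a, uup a * u a = -1 := by
    rw [← hunit]
    refine Finset.sum_congr rfl fun a _ => ?_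
    rw [huup, Finset.sum_mul]
    exact Finset.sum_congr rfl fun b _ => by ring
  have hgu (b : Fin 4) : ∑ c, g b c * uup c = u b := by
    simp_rw [huup, Finset.mul_sum, ← mul_assoc]
    rw [Finset.sum_comm]
    simp_rw [← Finset.sum_mul, hgginv]
    simp
  by_cases hw : μ + p = 0
  · simp [hw]
  obtain ⟨q, hq⟩ : ∃ q, pdot = (μ + p) * q := ⟨pdot / (μ + p), by field_simp⟩
  have hDp (a : Fin 4) : Dp a = -((μ + p) * (q * u a + udot a)) := by
    linear_combination hcons2 a - u a * hq
  have hDμ (a : Fin 4) : Dμ a = 3 * Dp a := by linear_combination -htraceconst a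
  have hyang (a b c : Fin 4) : -4 * (udot a * u b - udot b * u a) * u c
      + (Du a b - Du b a) * u c + u b * Du a c - u a * Du b c
      - (q * u a + udot a) * g b c + (q * u b + udot b) * g a c = 0 := by
    have h := hYang a b c
    rw [hDT, hDT, hDμ, hDμ, hDp, hDp] at h
    apply mul_left_cancel₀ hw
    linear_combination h
  simp only [Fin.sum_univ_four] at huu hgu hudot hpdot
  have hudot_u : ∑ a, uup a * udot a = 0 := by
    apply mul_left_cancel₀ hw
    simp only [Fin.sum_univ_four]
    rw [hDp, hDp, hDp, hDp] at hpdot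
    linear_combination hpdot - hq - (μ + p) * q * huu
  simp only [Fin.sum_univ_four] at hudot_u
  -- `N a = u^c ∇_a u_c`; it is not assumed to vanish.
  obtain ⟨N, hN⟩ : ∃ N : Fin 4 → ℝ, ∀ a, N a =
      uup 0 * Du a 0 + uup 1 * Du a 1 + uup 2 * Du a 2 + uup 3 * Du a 3 := ⟨_, fun _ => rfl⟩
  have hN_u : uup 0 * N 0 + uup 1 * N 1 + uup 2 * N 2 + uup 3 * N 3 = 0 := by
    rw [← hudot_u]
    simp only [hN, hudot]
    ring
  have hcurl (a b : Fin 4) : 3 * (udot a * u b - udot b * u a) - (Du a b - Du b a)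
      + u b * N a - u a * N b = 0 := by
    linear_combination uup 0 * hyang a b 0 + uup 1 * hyang a b 1 + uup 2 * hyang a b 2
      + uup 3 * hyang a b 3
      + (4 * (udot a * u b - udot b * u a) - (Du a b - Du b a)) * huu
      + u b * hN a - u a * hN b
      + (q * u a + udot a) * hgu b - (q * u b + udot b) * hgu a
  have hNudot (a : Fin 4) : N a = -udot a := by
    linear_combination (-1/2) * (uup 0 * hcurl a 0 + uup 1 * hcurl a 1 + uup 2 * hcurl a 2
      + uup 3 * hcurl a 3 - (3 * udot a + N a) * huu + 3 * u a * hudot_u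
      - hN a + hudot a + u a * hN_u)
  have hcurl' (a b : Fin 4) : Du a b - Du b a = 2 * (udot a * u b - udot b * u a) := by
    have h := hcurl a b
    rw [hNudot, hNudot] at h
    linear_combination -h
  obtain ⟨s, hs⟩ : ∃ s : Fin 4 → ℝ, ∀ c, s c =
      uup 0 * g 0 c + uup 1 * g 1 c + uup 2 * g 2 c + uup 3 * g 3 c := ⟨_, fun _ => rfl⟩
  have hDu (a c : Fin 4) : Du a c =
      2 * udot a * u c - u a * udot c - udot a * s c - q * (g a c + u a * s c) := by
    have h (b : Fin 4) : -2 * (udot a * u b - udot b * u a) * u c + u b * Du a c - u a * Du b c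
        - (q * u a + udot a) * g b c + (q * u b + udot b) * g a c = 0 := by
      linear_combination hyang a b c - u c * hcurl' a b
    linear_combination -(uup 0 * h 0 + uup 1 * h 1 + uup 2 * h 2 + uup 3 * h 3)
      + (-2 * udot a * u c + Du a c + q * g a c) * huu
      + (2 * u a * u c + g a c) * hudot_u + u a * hudot c + (q * u a + udot a) * hs c
  have hproj (a b c : Fin 4) :
      udot a * (g b c + u b * s c) = udot b * (g a c + u a * s c) := by
    linear_combination -hyang a b c + u c * hcurl' a b + u b * hDu a c - u a * hDu b c
  obtain ⟨σ, hσ⟩ : ∃ σ : Fin 4 → ℝ, ∀ d, σ d = ∑ c, s c * ginv c d := ⟨_, fun _ => rfl⟩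
  have hproj' (a b d : Fin 4) : udot a * ((if b = d then 1 else 0) + u b * σ d)
      = udot b * ((if a = d then 1 else 0) + u a * σ d) := by
    rw [← hgginv, ← hgginv, hσ]
    simp only [Fin.sum_univ_four]
    linear_combination ginv 0 d * hproj a b 0 + ginv 1 d * hproj a b 1
      + ginv 2 d * hproj a b 2 + ginv 3 d * hproj a b 3
  have hσu : ∑ d, u d * σ d = -1 := by
    simp only [hσ, Fin.sum_univ_four]
    simp only [Fin.sum_univ_four] at huup
    linear_combination huu - s 0 * huup 0 - s 1 * huup 1 - s 2 * huup 2 - s 3 * huup 3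
      + uup 0 * hs 0 + uup 1 * hs 1 + uup 2 * hs 2 + uup 3 * hs 3
      + uup 0 * hgu 0 + uup 1 * hgu 1 + uup 2 * hgu 2 + uup 3 * hgu 3
  have htrace (a : Fin 4) : 2 * udot a = u a * ∑ d, udot d * σ d := by
    have h : ∑ d, udot a * ((if d = d then 1 else 0) + u d * σ d)
        = ∑ d, udot d * ((if a = d then 1 else 0) + u a * σ d) :=
      Finset.sum_congr rfl fun d _ => hproj' a d d
    have hl : ∑ d, udot a * ((if d = d then 1 else 0) + u d * σ d) = 3 * udot a := by
      rw [← Finset.mul_sum, Finset.sum_add_distrib, hσu]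
      norm_num
      ring
    have hr : ∑ d, udot d * ((if a = d then 1 else 0) + u a * σ d)
        = udot a + u a * ∑ d, udot d * σ d := by
      simp only [mul_add, Finset.sum_add_distrib, Finset.mul_sum]
      simp [mul_left_comm]
    linear_combination h - hl + hr
  have hσudot : ∑ d, udot d * σ d = 0 := by
    linear_combination uup 0 * htrace 0 + uup 1 * htrace 1 + uup 2 * htrace 2
      + uup 3 * htrace 3 - 2 * hudot_u + (∑ d, udot d * σ d) * huu
  have hgeo (a : Fin 4) : udot a = 0 := by
    linear_combination (1/2) * htrace a + (1/2) * u a * hσudot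
  refine ⟨fun b c => ?_, fun a => by rw [hgeo, mul_zero], fun _ => hgeo⟩
  have h := hcurl' c b
  rw [hgeo, hgeo] at h ⊢
  linear_combination (-1/2) * (μ + p) * h
end

section
/- An antisymmetric tensor T_{abcd} = C_{ae[bc}P^e_{d]} on a 4-dimensional space has at most nine independent components: the trace conditions T^a{}_{acd} = 0 give six equations and the cyclic identity T_{[abc]d} = (1/3)T_{dabc} gives one more, reducing the naive count. -/
open Module in
/-- A subspace of dimension at most `n` is spanned by some family of `n` vectors. -/
lemma Submodule.exists_eq_span_range_of_finrank_le {K V : Type*} [DivisionRing K] [AddCommGroup V]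
    [Module K V] (W : Submodule K V) [FiniteDimensional K W] {n : ℕ} (h : finrank K W ≤ n) :
    ∃ v : Fin n → V, W = Submodule.span K (Set.range v) := by
  let b := finBasis K W
  let v : Fin n → V := fun i => if hi : (i : ℕ) < finrank K W then b ⟨i, hi⟩ else 0
  have hv : ∀ i, v (Fin.castLE h i) = b i := fun i => by simp [v]
  refine ⟨v, le_antisymm (fun x hx => ?_) (Submodule.span_le.2 ?_)⟩
  · have hsum := congrArg W.subtype (b.sum_repr ⟨x, hx⟩)
    simp only [map_sum, map_smul, Submodule.subtype_apply] at hsum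
    rw [← hsum]
    exact Submodule.sum_mem _ fun i _ => Submodule.smul_mem _ _
      (Submodule.subset_span ⟨Fin.castLE h i, hv i⟩)
  · rintro _ ⟨i, rfl⟩
    by_cases hi : (i : ℕ) < finrank K W <;> simp [v, hi]

/-- The symmetric matrices `N` with `tr (g N) = 0`. -/
def symmTraceFree {n : Type*} [Fintype n] (g : Matrix n n ℝ) : Submodule ℝ (Matrix n n ℝ) where
  carrier := {N | N.IsSymm ∧ (g * N).trace = 0}
  add_mem' := fun ha hb => ⟨ha.1.add hb.1, by simp [mul_add, ha.2, hb.2]⟩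
  zero_mem' := ⟨Matrix.isSymm_zero, by simp⟩
  smul_mem' := fun c _ ha => ⟨ha.1.smul c, by simp [ha.2]⟩

/-- A symmetric `N` with `tr (g N) = 0` vanishes as soon as its entries off a pair `s(p, q)` with
`g p q ≠ 0` do. -/
lemma eq_zero_of_mem_symmTraceFree {n : Type*} [Fintype n] {g N : Matrix n n ℝ}
    (hg : g.IsSymm) (hN : N ∈ symmTraceFree g) {p q : n} (hpq : g p q ≠ 0)
    (h : ∀ i j, s(i, j) ≠ s(p, q) → N i j = 0) : N = 0 := by
  classical
  obtain ⟨hsymm, htr⟩ := hN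
  have key : ∀ i j, g i j * N j i = if s(i, j) = s(p, q) then g p q * N p q else 0 := by
    intro i j
    split_ifs with hij
    · rcases Sym2.eq_iff.1 hij with ⟨rfl, rfl⟩ | ⟨rfl, rfl⟩
      · rw [hsymm.apply]
      · rw [hg.apply]
    · rw [h j i (by rwa [Sym2.eq_swap]), mul_zero]
  have hNpq : N p q = 0 := by
    simp only [Matrix.trace, Matrix.diag_apply, Matrix.mul_apply, key] at htr
    rw [← Finset.sum_product', ← Finset.sum_filter, Finset.sum_const, nsmul_eq_mul] at htr
    have hcard : ((Finset.univ ×ˢ Finset.univ : Finset (n × n)).filter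
        fun x => s(x.1, x.2) = s(p, q)).card ≠ 0 :=
      Finset.card_ne_zero_of_mem (a := (p, q)) (by simp)
    exact (mul_eq_zero.1 ((mul_eq_zero.1 htr).resolve_left (Nat.cast_ne_zero.2 hcard))).resolve_left
      hpq
  ext i j
  by_cases hij : s(i, j) = s(p, q)
  · rcases Sym2.eq_iff.1 hij with ⟨rfl, rfl⟩ | ⟨rfl, rfl⟩
    · exact hNpq
    · rw [hsymm.apply]; exact hNpq
  · exact h i j hij

lemma finrank_symmTraceFree_le {n : Type*} [Fintype n] {g : Matrix n n ℝ}
    (hg : g.IsSymm) (hg0 : g ≠ 0) :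
    Module.finrank ℝ (symmTraceFree g) ≤ (Fintype.card n + 1).choose 2 - 1 := by
  classical
  obtain ⟨p, q, hpq⟩ : ∃ p q, g p q ≠ 0 := by
    by_contra! h
    exact hg0 (Matrix.ext h)
  let entries : symmTraceFree g →ₗ[ℝ] ({z : Sym2 n // z ≠ s(p, q)} → ℝ) :=
    { toFun := fun N z => N.1 z.1.out.1 z.1.out.2
      map_add' := fun _ _ => rfl
      map_smul' := fun _ _ => rfl }
  have hinj : Function.Injective entries := by
    refine (injective_iff_map_eq_zero entries).2 fun N hN => Subtype.ext ?_
    refine eq_zero_of_mem_symmTraceFree hg N.2 hpq fun i j hij => ?_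
    have h0 : N.1 s(i, j).out.1 s(i, j).out.2 = 0 := congrFun hN ⟨s(i, j), hij⟩
    have hout : s(s(i, j).out.1, s(i, j).out.2) = s(i, j) := Quot.out_eq s(i, j)
    rcases Sym2.eq_iff.1 hout with ⟨h1, h2⟩ | ⟨h1, h2⟩
    · rwa [h1, h2] at h0
    · rw [h1, h2] at h0
      rwa [← N.2.1.apply]
  refine (LinearMap.finrank_le_finrank_of_injective hinj).trans_eq ?_
  rw [Module.finrank_fintype_fun_eq_card, Fintype.card_subtype_compl, Sym2.card,
    Fintype.card_subtype_eq]

/-- The tensors `T_{abcd}` antisymmetric in `b c` and in `c d`. -/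
def antisymmLastThree (n : Type*) : Submodule ℝ (n → n → n → n → ℝ) where
  carrier := {T | (∀ a b c d, T a b c d = -T a c b d) ∧ ∀ a b c d, T a b c d = -T a b d c}
  add_mem' := fun {S T} hS hT =>
    ⟨fun a b c d => by simp only [Pi.add_apply]; rw [hS.1, hT.1]; ring,
      fun a b c d => by simp only [Pi.add_apply]; rw [hS.2, hT.2]; ring⟩
  zero_mem' := by simp
  smul_mem' := fun r T hT =>
    ⟨fun a b c d => by simp only [Pi.smul_apply]; rw [hT.1, smul_neg],
      fun a b c d => by simp only [Pi.smul_apply]; rw [hT.2, smul_neg]⟩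

/-- The Hodge dual `M_a^e = (1/6) ε^{ebcd} T_{abcd}` on the last three indices of a tensor which is
antisymmetric in them. -/
def hodgeDual : (Fin 4 → Fin 4 → Fin 4 → Fin 4 → ℝ) →ₗ[ℝ] Matrix (Fin 4) (Fin 4) ℝ where
  toFun T := Matrix.of fun a e => (-1) ^ (e : ℕ) * T a (e + 1) (e + 2) (e + 3)
  map_add' S T := by ext; simp [mul_add]
  map_smul' r T := by ext; simp [mul_left_comm]

lemma eq_zero_of_hodgeDual_eq_zero {T : Fin 4 → Fin 4 → Fin 4 → Fin 4 → ℝ}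
    (hT : T ∈ antisymmLastThree (Fin 4)) (h : hodgeDual T = 0) : T = 0 := by
  obtain ⟨h1, h2⟩ := hT
  have hcases : ∀ b c d : Fin 4, b = c ∨ c = d ∨ b = d ∨ ∃ e,
      (b = e + 1 ∧ c = e + 2 ∧ d = e + 3) ∨ (b = e + 1 ∧ c = e + 3 ∧ d = e + 2) ∨
      (b = e + 2 ∧ c = e + 1 ∧ d = e + 3) ∨ (b = e + 2 ∧ c = e + 3 ∧ d = e + 1) ∨
      (b = e + 3 ∧ c = e + 1 ∧ d = e + 2) ∨ (b = e + 3 ∧ c = e + 2 ∧ d = e + 1) := by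
    decide
  have h0 : ∀ a e, T a (e + 1) (e + 2) (e + 3) = 0 := fun a e => by
    simpa [hodgeDual] using congrFun (congrFun h a) e
  ext a b c d
  rw [Pi.zero_apply, Pi.zero_apply, Pi.zero_apply, Pi.zero_apply]
  rcases hcases b c d with rfl | rfl | rfl | ⟨e, he⟩
  · linarith [h1 a b b d]
  · linarith [h2 a b c c]
  · linarith [h1 a b c b, h2 a c b b]
  · have := h0 a e
    rcases he with ⟨rfl, rfl, rfl⟩ | ⟨rfl, rfl, rfl⟩ | ⟨rfl, rfl, rfl⟩ | ⟨rfl, rfl, rfl⟩ |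
      ⟨rfl, rfl, rfl⟩ | ⟨rfl, rfl, rfl⟩
    · exact this
    · rw [h2, this, neg_zero]
    · rw [h1, this, neg_zero]
    · rw [h2, h1, this, neg_zero, neg_zero]
    · rw [h1, h2, this, neg_zero, neg_zero]
    · rw [h1, h2, h1, this, neg_zero, neg_zero, neg_zero]

/-- The cyclic identity says that the Hodge dual is trace-free. -/
lemma trace_hodgeDual_eq_zero {T : Fin 4 → Fin 4 → Fin 4 → Fin 4 → ℝ}
    (hT : T ∈ antisymmLastThree (Fin 4))
    (hcyc : ∀ a b c d, (1/6) * (T a b c d + T b c a d + T c a b d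
      - T b a c d - T a c b d - T c b a d) = (1/3) * T d a b c) :
    (hodgeDual T).trace = 0 := by
  obtain ⟨h1, h2⟩ := hT
  simp only [Matrix.trace, Matrix.diag_apply, hodgeDual, LinearMap.coe_mk, AddHom.coe_mk,
    Matrix.of_apply, Fin.sum_univ_four, Fin.reduceAdd, Fin.isValue]
  simp only [Fin.coe_ofNat_eq_mod]
  norm_num
  linarith [hcyc 0 1 2 3, h1 0 1 2 3, h1 1 0 2 3, h2 1 2 0 3, h1 1 2 3 0, h1 2 0 1 3, h2 2 3 0 1,
    h1 2 3 0 1, h2 2 0 3 1]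

/-- The trace condition says that the Hodge dual with its first index raised is symmetric. -/
lemma isSymm_transpose_mul_hodgeDual {ginv : Matrix (Fin 4) (Fin 4) ℝ}
    {T : Fin 4 → Fin 4 → Fin 4 → Fin 4 → ℝ} (hT : T ∈ antisymmLastThree (Fin 4))
    (htr : ∀ c d, ∑ a, ∑ b, ginv a b * T a b c d = 0) :
    (ginv.transpose * hodgeDual T).IsSymm := by
  obtain ⟨h1, h2⟩ := hT
  have hrefl : ∀ a b c, T a b b c = 0 := fun a b c => by linarith [h1 a b b c]
  have hrefl' : ∀ a b c, T a b c b = 0 := fun a b c => by rw [h2, hrefl, neg_zero]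
  have hsort : ∀ a b c d, b < c → T a c b d = -T a b c d := fun a b c d _ => h1 a c b d
  have hsort' : ∀ a b c d, c < d → T a b d c = -T a b c d := fun a b c d _ => h2 a b d c
  refine Matrix.IsSymm.ext fun i j => ?_
  simp only [Matrix.mul_apply, Matrix.transpose_apply, hodgeDual, LinearMap.coe_mk, AddHom.coe_mk,
    Matrix.of_apply]
  simp only [Fin.sum_univ_four] at htr ⊢
  have h01 := htr 0 1
  have h02 := htr 0 2
  have h03 := htr 0 3
  have h12 := htr 1 2
  have h13 := htr 1 3
  have h23 := htr 2 3
  simp [hrefl, hrefl', hsort, hsort'] at h01 h02 h03 h12 h13 h23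
  fin_cases i <;> fin_cases j <;> simp [hsort, hsort'] <;> linarith

/-- A tensor `T_{abcd}` on a 4-dimensional space (with nondegenerate symmetric
bilinear form `g`, inverse `ginv`) that is antisymmetric in its last three indices,
trace-free in all pairs, and satisfies the cyclic identity
`T_{[abc]d} = (1/3)T_{dabc}`, has at most nine independent components: all such
tensors lie in the span of nine fixed tensors. -/
theorem coc_tensor_at_most_nine_components
    (g ginv : Fin 4 → Fin 4 → ℝ)
    (hgsym : ∀ a b, g a b = g b a)
    (hginv : ∀ a b, (∑ e, g a e * ginv e b) = if a = b then (1:ℝ) else 0) :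
    ∃ basis : Fin 9 → (Fin 4 → Fin 4 → Fin 4 → Fin 4 → ℝ),
      ∀ T : Fin 4 → Fin 4 → Fin 4 → Fin 4 → ℝ,
        (∀ a b c d, T a b c d = -T a c b d) →
        (∀ a b c d, T a b c d = -T a b d c) →
        (∀ c d, (∑ a, ∑ b, ginv a b * T a b c d) = 0) →
        (∀ b d, (∑ a, ∑ c, ginv a c * T a b c d) = 0) →
        (∀ b c, (∑ a, ∑ d, ginv a d * T a b c d) = 0) →
        (∀ a b c d, (1/6) * (T a b c d + T b c a d + T c a b d
            - T b a c d - T a c b d - T c b a d) = (1/3) * T d a b c) →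
        T ∈ Submodule.span ℝ (Set.range basis) := by
  have hmul : Matrix.of g * Matrix.of ginv = 1 := by
    ext a b
    simpa [Matrix.mul_apply, Matrix.one_apply] using hginv a b
  have hgS : (Matrix.of g).IsSymm := Matrix.IsSymm.ext fun i j => hgsym j i
  have hmulT : Matrix.of g * (Matrix.of ginv).transpose = 1 := by
    rw [← hgS, ← Matrix.transpose_mul, mul_eq_one_comm.1 hmul, Matrix.transpose_one]
  have hg0 : Matrix.of g ≠ 0 := by
    intro h
    simp [h] at hmul
  let raise := LinearMap.mulLeft ℝ (Matrix.of ginv).transpose ∘ₗ hodgeDual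
  have hlower : ∀ T, Matrix.of g * raise T = hodgeDual T := fun T => by
    simp [raise, ← mul_assoc, hmulT]
  let W := antisymmLastThree (Fin 4) ⊓ (symmTraceFree (Matrix.of g)).comap raise
  let raiseW : W →ₗ[ℝ] symmTraceFree (Matrix.of g) := raise.restrict fun _ hT => hT.2
  have hinj : Function.Injective raiseW := by
    refine (injective_iff_map_eq_zero raiseW).2 fun T hT => Subtype.ext ?_
    refine eq_zero_of_hodgeDual_eq_zero T.2.1 ?_
    have hT' : raise T = 0 := congrArg Subtype.val hT
    rw [← hlower, hT', mul_zero]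
  have hW : Module.finrank ℝ W ≤ 9 :=
    (LinearMap.finrank_le_finrank_of_injective hinj).trans (finrank_symmTraceFree_le hgS hg0)
  obtain ⟨basis, hbasis⟩ := W.exists_eq_span_range_of_finrank_le hW
  refine ⟨basis, fun T h1 h2 htr _ _ hcyc => hbasis ▸ ?_⟩
  have hA : T ∈ antisymmLastThree (Fin 4) := ⟨h1, h2⟩
  refine ⟨hA, isSymm_transpose_mul_hodgeDual hA htr, ?_⟩
  rw [hlower]
  exact trace_hodgeDual_eq_zero hA hcyc
end
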